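/- The boundary layer operators satisfy the four identities: SH = −D² + I/4, HS = −(D')² + I/4, SD' = DS (Plemelj symmetrization principle), and D'H = HD, where I is the ∂Ω×∂Ω identity matrix. -/

import Mathlib

open Matrix BigOperators

noncomputable section

variable {V : Type*} [Fintype V] [DecidableEq V]

/-- Weighted graph Laplacian of a symmetric weight function. -/
def lap (σ : V → V → ℝ) : Matrix V V ℝ :=
  Matrix.of fun x y => if x = y then ∑ z, σ x z else -σ x y

/-- Restriction matrix `R_X : ℝ^V → ℝ^X`. -/
def restr (X : Finset V) : Matrix {x // x ∈ X} V ℝ :=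
  Matrix.of fun i j => if (i : V) = j then 1 else 0

/-- Green function `G = R_{V°}ᵀ (L[V°,V°])⁻¹ R_{V°}` with `V° = Bᶜ`. -/
def green (B : Finset V) (σ : V → V → ℝ) : Matrix V V ℝ :=
  (restr Bᶜ)ᵀ * (restr Bᶜ * lap σ * (restr Bᶜ)ᵀ)⁻¹ * restr Bᶜ

/-- Dirichlet trace operator `γ₀ = R_{∂Ω}`. -/
def gamma0 (dO : Finset V) : Matrix {x // x ∈ dO} V ℝ := restr dO

/-- Exterior Neumann trace operator `γ₁⁺ = -R_{∂Ω} L(σ⁺)`. -/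
def gamma1p (dO : Finset V) (σp : V → V → ℝ) : Matrix {x // x ∈ dO} V ℝ :=
  -(restr dO * lap σp)

/-- Interior Neumann trace operator `γ₁⁻ = R_{∂Ω} L(σ⁻)`. -/
def gamma1m (dO : Finset V) (σm : V → V → ℝ) : Matrix {x // x ∈ dO} V ℝ :=
  restr dO * lap σm

/-- Single layer potential `𝒮 = G γ₀ᵀ`. -/
def slp (B dO : Finset V) (σ : V → V → ℝ) : Matrix V {x // x ∈ dO} ℝ :=
  green B σ * (gamma0 dO)ᵀ

/-- Exterior double layer potential `𝒟⁺ = G (γ₁⁺)ᵀ`. -/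
def dlpP (B dO : Finset V) (σ σp : V → V → ℝ) : Matrix V {x // x ∈ dO} ℝ :=
  green B σ * (gamma1p dO σp)ᵀ

/-- Interior double layer potential `𝒟⁻ = G (γ₁⁻)ᵀ`. -/
def dlpM (B dO : Finset V) (σ σm : V → V → ℝ) : Matrix V {x // x ∈ dO} ℝ :=
  green B σ * (gamma1m dO σm)ᵀ

/-- Single layer boundary operator `S = γ₀ 𝒮`. -/
def Sop (B dO : Finset V) (σ : V → V → ℝ) : Matrix {x // x ∈ dO} {x // x ∈ dO} ℝ :=
  gamma0 dO * slp B dO σ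

/-- Double layer boundary operator `D = ½ γ₀ (𝒟⁺ + 𝒟⁻)`. -/
def Dop (B dO : Finset V) (σ σp σm : V → V → ℝ) : Matrix {x // x ∈ dO} {x // x ∈ dO} ℝ :=
  (1/2 : ℝ) • (gamma0 dO * (dlpP B dO σ σp + dlpM B dO σ σm))

/-- Adjoint double layer (Neumann–Poincaré) operator `D' = ½ (γ₁⁺ + γ₁⁻) 𝒮`. -/
def Dadj (B dO : Finset V) (σ σp σm : V → V → ℝ) : Matrix {x // x ∈ dO} {x // x ∈ dO} ℝ :=
  (1/2 : ℝ) • ((gamma1p dO σp + gamma1m dO σm) * slp B dO σ)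

/-- Hypersingular operator `H = -γ₁⁺ 𝒟⁻`. -/
def Hop (B dO : Finset V) (σ σp σm : V → V → ℝ) : Matrix {x // x ∈ dO} {x // x ∈ dO} ℝ :=
  -(gamma1p dO σp * dlpM B dO σ σm)

/-- Indicator vector of a node subset. -/
def ind (X : Finset V) : V → ℝ := fun x => if x ∈ X then 1 else 0

/-- The subgraph with node set `A` and edges `{x,y}` with `w x y > 0` is connected. -/
def connOn (A : Finset V) (w : V → V → ℝ) : Prop :=
  ∀ x ∈ A, ∀ y ∈ A, Relation.ReflTransGen (fun a b => a ∈ A ∧ b ∈ A ∧ 0 < w a b) x y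

lemma restr_transpose_mul_restr (X : Finset V) :
    (restr X)ᵀ * restr X = diagonal (ind X) := by
  ext x y
  simp only [Matrix.mul_apply, Matrix.transpose_apply, restr, Matrix.of_apply, diagonal_apply, ind]
  by_cases hx : x ∈ X
  · rw [Finset.sum_eq_single (⟨x, hx⟩ : {x // x ∈ X})]
    · simp [hx]
    · intro b _ hb
      have : (b : V) ≠ x := fun h => hb (Subtype.ext h)
      simp [this]
    · simp
  · rw [Finset.sum_eq_zero]
    · simp [hx]
    · intro b _
      have : (b : V) ≠ x := fun h => hx (h ▸ b.2)
      simp [this]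

lemma restr_mul_apply {n : Type*} (X : Finset V) (A : Matrix V n ℝ) (x : {x // x ∈ X}) (y : n) :
    (restr X * A) x y = A x y := by
  simp [Matrix.mul_apply, restr]

lemma restr_mul_restr_transpose (X : Finset V) : restr X * (restr X)ᵀ = 1 := by
  ext x y
  rw [restr_mul_apply, Matrix.transpose_apply, Matrix.one_apply]
  simp only [restr, Matrix.of_apply, Subtype.ext_iff, eq_comm (a := (y : V))]

lemma restr_mul_diagonal_ind_of_subset {X Y : Finset V} (h : X ⊆ Y) :
    restr X * diagonal (ind Y) = restr X := by
  ext x y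
  simp only [Matrix.mul_diagonal, restr, Matrix.of_apply, ind]
  by_cases hxy : (x : V) = y
  · simp [← hxy, h x.2]
  · simp [hxy]

lemma restr_mul_diagonal_ind_of_disjoint {X Y : Finset V} (h : Disjoint X Y) :
    restr X * diagonal (ind Y) = 0 := by
  ext x y
  simp only [Matrix.mul_diagonal, restr, Matrix.of_apply, ind, Matrix.zero_apply]
  by_cases hxy : (x : V) = y
  · simp [← hxy, Finset.disjoint_left.mp h x.2]
  · simp [hxy]

lemma lap_transpose {σ : V → V → ℝ} (h : ∀ x y, σ x y = σ y x) : (lap σ)ᵀ = lap σ := by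
  ext x y
  by_cases hxy : x = y
  · simp [lap, hxy]
  · simp [lap, hxy, Ne.symm hxy, h x y]

lemma lap_add {σ σp σm : V → V → ℝ} (h : ∀ x y, σp x y + σm x y = σ x y) :
    lap σp + lap σm = lap σ := by
  ext x y
  by_cases hxy : x = y
  · simp [lap, hxy, ← h, Finset.sum_add_distrib]
  · simp [lap, hxy, ← h, add_comm]

lemma green_transpose (B : Finset V) {σ : V → V → ℝ} (h : ∀ x y, σ x y = σ y x) :
    (green B σ)ᵀ = green B σ := by
  simp [green, Matrix.transpose_mul, Matrix.transpose_nonsing_inv, lap_transpose h,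
    Matrix.mul_assoc]

lemma green_mul_diagonal (B : Finset V) (σ : V → V → ℝ) :
    green B σ * diagonal (ind Bᶜ) = green B σ := by
  rw [green, Matrix.mul_assoc, restr_mul_diagonal_ind_of_subset subset_rfl]

lemma diagonal_mul_lap_mul_green {B : Finset V} {σ : V → V → ℝ}
    (h : IsUnit (restr Bᶜ * lap σ * (restr Bᶜ)ᵀ)) :
    diagonal (ind Bᶜ) * lap σ * green B σ = diagonal (ind Bᶜ) := by
  have h' := Matrix.mul_nonsing_inv _ ((Matrix.isUnit_iff_isUnit_det _).mp h)
  calc diagonal (ind Bᶜ) * lap σ * green B σ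
      = (restr Bᶜ)ᵀ * ((restr Bᶜ * lap σ * (restr Bᶜ)ᵀ) *
          (restr Bᶜ * lap σ * (restr Bᶜ)ᵀ)⁻¹) * restr Bᶜ := by
        rw [← restr_transpose_mul_restr, green]; simp only [Matrix.mul_assoc]
    _ = diagonal (ind Bᶜ) := by rw [h', Matrix.mul_one, restr_transpose_mul_restr]

/-- Sandwiching the commutator of `lap σ` with an indicator between Green functions. -/
lemma green_mul_commutator_mul_green {B : Finset V} {σ : V → V → ℝ}
    (hσ : ∀ x y, σ x y = σ y x) (h : IsUnit (restr Bᶜ * lap σ * (restr Bᶜ)ᵀ)) (X : Finset V) :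
    green B σ * (lap σ * diagonal (ind X) - diagonal (ind X) * lap σ) * green B σ
      = diagonal (ind X) * green B σ - green B σ * diagonal (ind X) := by
  have key : green B σ * diagonal (ind X) * lap σ * green B σ
      = green B σ * diagonal (ind X) := by
    have hc : diagonal (ind Bᶜ) * diagonal (ind X) = diagonal (ind X) * diagonal (ind Bᶜ) := by
      simp [Matrix.diagonal_mul_diagonal, mul_comm]
    calc green B σ * diagonal (ind X) * lap σ * green B σ
        = green B σ * (diagonal (ind Bᶜ) * diagonal (ind X)) * lap σ * green B σ := by
          rw [← Matrix.mul_assoc, green_mul_diagonal]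
      _ = green B σ * diagonal (ind X) * (diagonal (ind Bᶜ) * lap σ * green B σ) := by
          rw [hc]; simp only [Matrix.mul_assoc]
      _ = green B σ * (diagonal (ind Bᶜ) * diagonal (ind X)) := by
          rw [diagonal_mul_lap_mul_green h, hc]; simp only [Matrix.mul_assoc]
      _ = green B σ * diagonal (ind X) := by rw [← Matrix.mul_assoc, green_mul_diagonal]
  have key' := congrArg Matrix.transpose key
  simp only [Matrix.transpose_mul, green_transpose B hσ, lap_transpose hσ,
    Matrix.diagonal_transpose] at key'
  simp only [Matrix.mul_sub, Matrix.sub_mul, Matrix.mul_assoc] at key key' ⊢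
  rw [key, key']

/-- The Calderón-type identities for abstract trace, Green and split Laplacian matrices. -/
lemma calderon_identities {n : Type*} [Fintype n] [DecidableEq n]
    (R : Matrix n V ℝ) (G Lp Lm P : Matrix V V ℝ)
    (hG : Gᵀ = G) (hLp : Lpᵀ = Lp) (hLm : Lmᵀ = Lm) (hP : Pᵀ = P)
    (hRR : R * Rᵀ = 1) (hRL : R * (Lp + Lm) * G = R)
    (hE : G * (Rᵀ * R * Lp - Lp * (Rᵀ * R)) * G = P * G - G * P)
    (hRP : R * P = 0) (hRLP : R * Lm * P = 0)
    {S H D D' : Matrix n n ℝ} (hS : S = R * (G * Rᵀ))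
    (hH : H = -(-(R * Lp) * (G * (R * Lm)ᵀ)))
    (hD : D = (1 / 2 : ℝ) • (R * (G * (-(R * Lp))ᵀ + G * (R * Lm)ᵀ)))
    (hD' : D' = (1 / 2 : ℝ) • ((-(R * Lp) + R * Lm) * (G * Rᵀ))) :
    S * H = -(D * D) + (1 / 4 : ℝ) • 1 ∧ H * S = -(D' * D') + (1 / 4 : ℝ) • 1 ∧
      S * D' = D * S ∧ D' * H = H * D := by
  have hPR : P * Rᵀ = 0 := by
    have := congrArg Matrix.transpose hRP
    simpa [Matrix.transpose_mul, hP] using this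
  have hPLR : P * (Lm * Rᵀ) = 0 := by
    have := congrArg Matrix.transpose hRLP
    simpa [Matrix.transpose_mul, hP, hLm] using this
  have hST : Sᵀ = S := by simp [hS, Matrix.transpose_mul, hG, Matrix.mul_assoc]
  have hDT : D'ᵀ = D := by
    simp [hD, hD', Matrix.transpose_mul, Matrix.transpose_smul, hG, hLp, hLm, Matrix.mul_assoc,
      Matrix.mul_add, Matrix.add_mul]
  have hRLp : R * (Lp * G) = R - R * (Lm * G) := by
    rw [eq_sub_iff_add_eq]
    simpa only [Matrix.mul_add, Matrix.add_mul, Matrix.mul_assoc] using hRL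
  have hHT : Hᵀ = H := by
    have h1 : H = R * (Lm * Rᵀ) - R * (Lm * (G * (Lm * Rᵀ))) := by
      have := congrArg (· * (Lm * Rᵀ)) hRLp
      simp only [Matrix.sub_mul, Matrix.mul_assoc] at this
      simp only [hH, Matrix.transpose_mul, hLm, Matrix.neg_mul, neg_neg, Matrix.mul_assoc, this]
    simp [h1, Matrix.transpose_mul, hG, hLm, Matrix.mul_assoc]
  obtain ⟨M, hM⟩ : ∃ M, M = R * (Lm * (G * Rᵀ)) := ⟨_, rfl⟩
  have hN : R * (Lp * (G * Rᵀ)) = 1 - M := by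
    have := congrArg (· * Rᵀ) hRLp
    simp only [Matrix.sub_mul, Matrix.mul_assoc, hRR] at this
    rw [this, hM]
  have hMT : Mᵀ = R * (G * (Lm * Rᵀ)) := by
    simp [hM, Matrix.transpose_mul, hG, hLm, Matrix.mul_assoc]
  have hNT : R * (G * (Lp * Rᵀ)) = 1 - Mᵀ := by
    rw [← Matrix.transpose_one, ← Matrix.transpose_sub, ← hN]
    simp [Matrix.transpose_mul, hG, hLp, Matrix.mul_assoc]
  have hD'M : D' = M - (1 / 2 : ℝ) • 1 := by
    rw [hD']
    simp only [Matrix.add_mul, Matrix.neg_mul, Matrix.mul_assoc, hN, ← hM]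
    module
  have hDM : D = Mᵀ - (1 / 2 : ℝ) • 1 := by
    rw [← hDT, hD'M]; simp
  have hH' : H = R * (Lp * (G * (Lm * Rᵀ))) := by
    simp [hH, Matrix.transpose_mul, hLm, Matrix.mul_assoc]
  have sandwich : ∀ (A : Matrix n V ℝ) (C : Matrix V n ℝ), A * P = 0 → P * C = 0 →
      A * (G * (Rᵀ * (R * (Lp * (G * C))))) = A * (G * (Lp * (Rᵀ * (R * (G * C))))) := by
    intro A C hA hC
    have := congrArg (A * · * C) hE
    have hA' : ∀ X : Matrix V n ℝ, A * (P * X) = 0 := fun X => by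
      rw [← Matrix.mul_assoc, hA, Matrix.zero_mul]
    simp only [Matrix.mul_sub, Matrix.sub_mul, Matrix.mul_assoc, hA', hC, Matrix.mul_zero,
      sub_zero] at this
    exact sub_eq_zero.mp this
  have e1 : S * H = (1 - Mᵀ) * Mᵀ := by
    have := sandwich R (Lm * Rᵀ) hRP hPLR
    rw [hS, hH', ← hNT, hMT]
    simpa only [Matrix.mul_assoc] using this
  have e2 : H * S = M * (1 - M) := by
    have := congrArg Matrix.transpose e1
    simpa only [Matrix.transpose_mul, hST, hHT, Matrix.transpose_sub, Matrix.transpose_one,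
      Matrix.transpose_transpose] using this
  have e3 : S * M = Mᵀ * S := by
    have := sandwich R Rᵀ hRP hPR
    have h : S * (1 - M) = (1 - Mᵀ) * S := by
      rw [hS, ← hNT, ← hN]
      simpa only [Matrix.mul_assoc] using this
    simpa [Matrix.mul_sub, Matrix.sub_mul] using h
  have e4 : M * H = H * Mᵀ := by
    have := sandwich (R * Lm) (Lm * Rᵀ) hRLP hPLR
    have h : H * Mᵀ = (R * (Lm * (G * (Lp * Rᵀ)))) * (R * (G * (Lm * Rᵀ))) := by
      rw [hMT]
      conv_lhs => rw [← hHT, hH']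
      simp [Matrix.transpose_mul, hG, hLp, hLm, Matrix.mul_assoc]
    rw [h, hM, hH']
    simpa only [Matrix.mul_assoc] using this
  refine ⟨?_, ?_, ?_, ?_⟩
  · rw [e1, hDM]
    simp only [Matrix.mul_sub, Matrix.sub_mul, Matrix.mul_smul, Matrix.smul_mul, Matrix.mul_one,
      Matrix.one_mul]
    module
  · rw [e2, hD'M]
    simp only [Matrix.mul_sub, Matrix.sub_mul, Matrix.mul_smul, Matrix.smul_mul, Matrix.mul_one,
      Matrix.one_mul]
    module
  · rw [hD'M, hDM, Matrix.mul_sub, Matrix.sub_mul, e3]; simp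
  · rw [hD'M, hDM, Matrix.mul_sub, Matrix.sub_mul, e4]; simp

theorem stmt_9
    {V : Type*} [Fintype V] [DecidableEq V]
    (B Op dO Om : Finset V)
    (hBne : B.Nonempty) (hOpne : Op.Nonempty) (hdOne : dO.Nonempty) (hOmne : Om.Nonempty)
    (hd1 : Disjoint B Op) (hd2 : Disjoint B dO) (hd3 : Disjoint B Om)
    (hd4 : Disjoint Op dO) (hd5 : Disjoint Op Om) (hd6 : Disjoint dO Om)
    (hcover : B ∪ Op ∪ dO ∪ Om = Finset.univ)
    (σ σp σm : V → V → ℝ)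
    (hσsymm : ∀ x y, σ x y = σ y x) (hσdiag : ∀ x, σ x x = 0)
    (hσnn : ∀ x y, 0 ≤ σ x y)
    (hsepBdO : ∀ x ∈ B, ∀ y ∈ dO, σ x y = 0)
    (hsepBOm : ∀ x ∈ B, ∀ y ∈ Om, σ x y = 0)
    (hsepOpOm : ∀ x ∈ Op, ∀ y ∈ Om, σ x y = 0)
    (hσpsymm : ∀ x y, σp x y = σp y x) (hσpdiag : ∀ x, σp x x = 0)
    (hσmsymm : ∀ x y, σm x y = σm y x) (hσmdiag : ∀ x, σm x x = 0)
    (hσpnn : ∀ x y, 0 ≤ σp x y) (hσmnn : ∀ x y, 0 ≤ σm x y)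
    (hsum : ∀ x y, σp x y + σm x y = σ x y)
    (hp1 : ∀ x y, x ∈ B ∪ Op ∨ y ∈ B ∪ Op → σp x y = σ x y)
    (hm1 : ∀ x y, x ∈ Om ∨ y ∈ Om → σm x y = σ x y)
    (hpd : (restr Bᶜ * lap σ * (restr Bᶜ)ᵀ).PosDef) :
    Sop B dO σ * Hop B dO σ σp σm
        = -(Dop B dO σ σp σm * Dop B dO σ σp σm) + (1/4 : ℝ) • (1 : Matrix {x // x ∈ dO} {x // x ∈ dO} ℝ)
    ∧ Hop B dO σ σp σm * Sop B dO σ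
        = -(Dadj B dO σ σp σm * Dadj B dO σ σp σm) + (1/4 : ℝ) • (1 : Matrix {x // x ∈ dO} {x // x ∈ dO} ℝ)
    ∧ Sop B dO σ * Dadj B dO σ σp σm = Dop B dO σ σp σm * Sop B dO σ
    ∧ Dadj B dO σ σp σm * Hop B dO σ σp σm = Hop B dO σ σp σm * Dop B dO σ σp σm := by
  have hpart : ∀ x, x ∈ B ∪ Op ∨ x ∈ dO ∨ x ∈ Om := fun x => by
    have : x ∈ B ∪ Op ∪ dO ∪ Om := hcover ▸ Finset.mem_univ x
    simp only [Finset.mem_union] at this ⊢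
    tauto
  have hdisj : Disjoint dO (B ∪ Op) := Finset.disjoint_union_right.mpr ⟨hd2.symm, hd4.symm⟩
  have hdisj' : Disjoint Om (B ∪ Op) := Finset.disjoint_union_right.mpr ⟨hd3.symm, hd5.symm⟩
  have hcomm : diagonal (ind dO) * lap σp - lap σp * diagonal (ind dO)
      = lap σ * diagonal (ind (B ∪ Op)) - diagonal (ind (B ∪ Op)) * lap σ := by
    ext x y
    simp only [Matrix.sub_apply, Matrix.diagonal_mul, Matrix.mul_diagonal]
    by_cases hxy : x = y
    · subst hxy; ring
    have key : ∀ z, (z ∈ B ∪ Op ∧ ind (B ∪ Op) z = 1 ∧ ind dO z = 0) ∨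
        (z ∈ dO ∧ ind (B ∪ Op) z = 0 ∧ ind dO z = 1) ∨
        (z ∈ Om ∧ ind (B ∪ Op) z = 0 ∧ ind dO z = 0) := fun z => by
      rcases hpart z with h | h | h
      · exact Or.inl ⟨h, if_pos h, if_neg (Finset.disjoint_right.mp hdisj h)⟩
      · exact Or.inr (Or.inl ⟨h, if_neg (Finset.disjoint_left.mp hdisj h), if_pos h⟩)
      · exact Or.inr (Or.inr ⟨h, if_neg (Finset.disjoint_left.mp hdisj' h),
          if_neg (Finset.disjoint_right.mp hd6 h)⟩)
    have hs := hsum x y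
    have hp := hp1 x y
    have hm := hm1 x y
    simp only [lap, Matrix.of_apply, if_neg hxy]
    rcases key x with ⟨hx, h1, h2⟩ | ⟨hx, h1, h2⟩ | ⟨hx, h1, h2⟩ <;>
      rcases key y with ⟨hy, h3, h4⟩ | ⟨hy, h3, h4⟩ | ⟨hy, h3, h4⟩ <;>
      simp only [h1, h2, h3, h4, hx, hy, true_or, or_true, forall_const] at hp hm ⊢ <;>
      linarith
  have hRLP : restr dO * lap σm * diagonal (ind (B ∪ Op)) = 0 := by
    ext x y
    rw [Matrix.mul_diagonal, restr_mul_apply, Matrix.zero_apply]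
    by_cases hy : y ∈ B ∪ Op
    · have hxy : (x : V) ≠ y := fun h => Finset.disjoint_left.mp hdisj x.2 (h ▸ hy)
      have hz : σm x y = 0 := by linarith [hsum x y, hp1 x y (Or.inr hy)]
      simp [lap, hxy, hz]
    · simp [ind, hy]
  have hsub : dO ⊆ Bᶜ := fun x hx => Finset.mem_compl.mpr (Finset.disjoint_right.mp hd2 hx)
  refine calderon_identities (restr dO) (green B σ) (lap σp) (lap σm) (diagonal (ind (B ∪ Op)))
    (green_transpose B hσsymm) (lap_transpose hσpsymm) (lap_transpose hσmsymm)
    (Matrix.diagonal_transpose _) (restr_mul_restr_transpose dO) ?_ ?_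
    (restr_mul_diagonal_ind_of_disjoint hdisj) hRLP rfl rfl rfl rfl
  · rw [lap_add hsum, ← restr_mul_diagonal_ind_of_subset hsub, Matrix.mul_assoc, Matrix.mul_assoc,
      ← Matrix.mul_assoc (diagonal _), diagonal_mul_lap_mul_green hpd.isUnit]
  · rw [restr_transpose_mul_restr, hcomm, green_mul_commutator_mul_green hσsymm hpd.isUnit]
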